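/- Let c ≥ 1/√(2π), let L ⊂ ℝ^n be a full-rank lattice, let 0 < ε < 1, and let S ∈ ℝ^{n×n} be invertible such that ρ_{1/σ_n(S)}(L* ∖ {0}) = Σ_{y ∈ L*∖{0}} exp(−π σ_n(S)² ‖y‖²) ≤ ε (i.e., σ_n(S) ≥ η_ε(L)). Then the probability under D_{L,S} of the set {v ∈ L : ‖v‖ ≥ σ_1(S)·c·√n} is at most ((1+ε)/(1−ε)) · (c·√(2πe)·e^{−πc²})^n. -/

import Mathlib

open scoped BigOperators Matrix
attribute [local instance] Classical.propDecidable

/-- Ellipsoidal Gaussian function `ρ_S(x) = exp(-π xᵀ (SᵀS)⁻¹ x)` for a (rank-`n`)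
matrix `S ∈ ℝ^{m×n}` and `x ∈ ℝ^n`. -/
noncomputable def rho {m n : ℕ} (S : Matrix (Fin m) (Fin n) ℝ) (x : Fin n → ℝ) : ℝ :=
  Real.exp (-Real.pi * (x ⬝ᵥ ((Sᵀ * S)⁻¹ *ᵥ x)))

/-- Coordinatewise cast of an integer vector to a real vector. -/
def intCast' {k : ℕ} (v : Fin k → ℤ) : Fin k → ℝ := fun i => (v i : ℝ)

/-- Euclidean (ℓ2) norm of a real vector. -/
noncomputable def enorm' {k : ℕ} (x : Fin k → ℝ) : ℝ := Real.sqrt (∑ i, (x i) ^ 2)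

open MeasureTheory
open scoped ENNReal

section GaussianSums

variable {E : Type*} [NormedAddCommGroup E]

/-- The spherical Gaussian `exp (-π t ‖x‖²)`, valued in `ℝ≥0∞`. -/
noncomputable def gaussianWeight (t : ℝ) (x : E) : ℝ≥0∞ :=
  ENNReal.ofReal (Real.exp (-Real.pi * t * ‖x‖ ^ 2))

theorem gaussianWeight_neg (t : ℝ) (x : E) : gaussianWeight t (-x) = gaussianWeight t x := by
  simp [gaussianWeight]

theorem measurable_gaussianWeight [MeasurableSpace E] [BorelSpace E] (t : ℝ) :
    Measurable (gaussianWeight t : E → ℝ≥0∞) := by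
  unfold gaussianWeight
  fun_prop

theorem lintegral_mul_eq_setLIntegral_mul_tsum [MeasurableSpace E] [BorelSpace E]
    {μ : Measure E} [μ.IsAddLeftInvariant]
    {L : AddSubgroup E} [Countable L] {D : Set E} (hD : IsAddFundamentalDomain L D μ)
    {F f : E → ℝ≥0∞} (hF : Measurable F) (hf : Measurable f)
    (hper : ∀ (y : L) (x : E), F (y + x) = F x) :
    ∫⁻ x, F x * f x ∂μ = ∫⁻ x in D, F x * ∑' y : L, f (y + x) ∂μ := by
  rw [hD.lintegral_eq_tsum'', ← lintegral_tsum]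
  · simp_rw [AddSubgroup.vadd_def, vadd_eq_add, hper, ENNReal.tsum_mul_left]
  · intro y
    have := (hF.mul hf).comp (measurable_const_add (y : E))
    exact this.aemeasurable

variable [InnerProductSpace ℝ E]

theorem gaussianWeight_sub_mul {a b : ℝ} (hab : 0 < a + b) (x w : E) :
    gaussianWeight a (x - w) * gaussianWeight b w =
      gaussianWeight (a * b / (a + b)) x * gaussianWeight (a + b) (w - (a / (a + b)) • x) := by
  simp only [gaussianWeight]
  rw [← ENNReal.ofReal_mul (Real.exp_pos _).le, ← ENNReal.ofReal_mul (Real.exp_pos _).le,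
    ← Real.exp_add, ← Real.exp_add, norm_sub_sq_real, norm_sub_sq_real, norm_smul,
    real_inner_smul_right, real_inner_comm w x, Real.norm_eq_abs, mul_pow, sq_abs]
  congr 2
  field_simp
  ring

variable [FiniteDimensional ℝ E] [MeasurableSpace E] [BorelSpace E]

theorem lintegral_gaussianWeight {t : ℝ} (ht : 0 < t) :
    ∫⁻ x : E, gaussianWeight t x = ENNReal.ofReal ((1 / t) ^ (Module.finrank ℝ E / 2 : ℝ)) := by
  have hpi := Real.pi_pos
  have hb : 0 < Real.pi * t := by positivity
  have key := GaussianFourier.integral_rexp_neg_mul_sq_norm (V := E) hb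
  have hint : Integrable fun x : E => Real.exp (-(Real.pi * t) * ‖x‖ ^ 2) := by
    by_contra h
    rw [integral_undef h] at key
    exact absurd key (by positivity)
  rw [show Real.pi / (Real.pi * t) = 1 / t by field_simp] at key
  rw [← key, ofReal_integral_eq_lintegral_ofReal hint (.of_forall fun x => (Real.exp_pos _).le)]
  simp [gaussianWeight]

theorem lintegral_gaussianWeight_sub_mul {a b : ℝ} (hab : 0 < a + b) (x : E) :
    ∫⁻ w, gaussianWeight a (x - w) * gaussianWeight b w =
      gaussianWeight (a * b / (a + b)) x * ∫⁻ w : E, gaussianWeight (a + b) w := by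
  simp_rw [gaussianWeight_sub_mul hab]
  rw [lintegral_const_mul _ (by
    exact (measurable_gaussianWeight _).comp (measurable_sub_const ((a / (a + b)) • x))),
    lintegral_sub_right_eq_self (gaussianWeight (a + b))]

theorem ENNReal.two_mul_mul_le_sq_add_sq (a b : ℝ≥0∞) : 2 * (a * b) ≤ a * a + b * b := by
  rcases eq_or_ne a ∞ with rfl | ha
  · simp
  rcases eq_or_ne b ∞ with rfl | hb
  · simp
  lift a to NNReal using ha
  lift b to NNReal using hb
  norm_cast
  rw [← NNReal.coe_le_coe]
  push_cast
  nlinarith [sq_nonneg ((a : ℝ) - b)]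

/-- Among all translates of a lattice, the lattice itself has the largest Gaussian mass. -/
theorem tsum_gaussianWeight_add_le {L : AddSubgroup E} [Countable L] {D : Set E}
    (hD : IsAddFundamentalDomain L D (volume : Measure E)) (u : E) :
    ∑' y : L, gaussianWeight 1 (y + u) ≤ ∑' y : L, gaussianWeight 1 (y : E) := by
  let G : E → ℝ≥0∞ := fun w => ∑' y : L, gaussianWeight 2 (y + w)
  have hG : Measurable G :=
    .tsum fun y => (measurable_gaussianWeight 2).comp (measurable_const_add (y : E))
  have hper (y : L) (x : E) : G (y + x) = G x := by
    have := (Equiv.addRight y).tsum_eq (fun z : L => gaussianWeight 2 ((z : E) + x))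
    simpa [G, add_assoc] using this
  set C : ℝ≥0∞ := ∫⁻ w : E, gaussianWeight 4 w with hC
  have hC' := lintegral_gaussianWeight (E := E) (t := 4) (by norm_num)
  have hC0 : C ≠ 0 := by
    rw [hC, hC', Ne, ENNReal.ofReal_eq_zero, not_le]
    positivity
  have hCtop : C ≠ ∞ := by rw [hC, hC']; exact ENNReal.ofReal_ne_top
  have hconv (v : E) : (∑' y : L, gaussianWeight 1 (y + v)) * C =
      ∫⁻ w, G (v - w) * gaussianWeight 2 w := by
    rw [← ENNReal.tsum_mul_right]
    simp_rw [G, ← ENNReal.tsum_mul_right]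
    rw [lintegral_tsum]
    · refine tsum_congr fun y => ?_
      have := lintegral_gaussianWeight_sub_mul (a := 2) (b := 2) (by norm_num) (y + v : E)
      norm_num at this
      simp_rw [hC, ← this, add_sub_assoc]
    · intro y
      refine Measurable.aemeasurable (.mul ?_ (measurable_gaussianWeight 2))
      exact (measurable_gaussianWeight 2).comp
        ((measurable_const_add (y : E)).comp (measurable_const_sub v))
  have hneg (w : E) : G (-w) = G w := by
    refine Eq.trans (tsum_congr fun y => ?_)
      ((Equiv.neg L).tsum_eq (fun z : L => gaussianWeight 2 ((z : E) + w)))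
    rw [← gaussianWeight_neg]
    simp [add_comm]
  have hGu : Measurable fun w => G (u - w) := hG.comp (measurable_const_sub u)
  have hperu (y : L) (x : E) : G (u - (y + x)) = G (u - x) := by
    rw [← hper y (u - (y + x))]
    congr 1
    abel
  have hsq : ∫⁻ w in D, G w * G w = (∑' y : L, gaussianWeight 1 (y : E)) * C := by
    have := hconv 0
    simp only [add_zero, zero_sub, hneg] at this
    rw [this, lintegral_mul_eq_setLIntegral_mul_tsum hD hG (measurable_gaussianWeight 2) hper]
  have hsqu : ∫⁻ w in D, G (u - w) * G (u - w) = (∑' y : L, gaussianWeight 1 (y : E)) * C := by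
    have h1 := lintegral_mul_eq_setLIntegral_mul_tsum hD hGu
      ((measurable_gaussianWeight 2).comp (measurable_sub_const u)) hperu
    have h2 (w : E) : G (u - w) = ∑' y : L, gaussianWeight 2 ((y : E) + w - u) := by
      rw [← hneg, neg_sub]
      simp only [G, add_sub_assoc]
    have h3 := hconv 0
    simp only [add_zero, zero_sub, hneg] at h3
    simp only [Function.comp_apply, add_sub_assoc] at h1 h2
    simp only [← h2] at h1
    rw [h3, ← lintegral_sub_right_eq_self (fun w => G w * gaussianWeight 2 w) u, ← h1]
    refine lintegral_congr fun w => ?_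
    rw [← hneg (w - u), neg_sub]
  have hprod : (∑' y : L, gaussianWeight 1 (y + u)) * C = ∫⁻ w in D, G (u - w) * G w := by
    rw [hconv u, lintegral_mul_eq_setLIntegral_mul_tsum hD hGu (measurable_gaussianWeight 2) hperu]
  have hle : 2 * ((∑' y : L, gaussianWeight 1 (y + u)) * C) ≤
      2 * ((∑' y : L, gaussianWeight 1 (y : E)) * C) := by
    calc 2 * ((∑' y : L, gaussianWeight 1 (y + u)) * C)
        = ∫⁻ w in D, 2 * (G (u - w) * G w) := by
          rw [hprod]
          exact (lintegral_const_mul _ (hGu.mul hG)).symm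
      _ ≤ ∫⁻ w in D, (G (u - w) * G (u - w) + G w * G w) :=
          lintegral_mono fun w => ENNReal.two_mul_mul_le_sq_add_sq _ _
      _ = 2 * ((∑' y : L, gaussianWeight 1 (y : E)) * C) := by
          refine (lintegral_add_left (hGu.mul hGu) _).trans ?_
          rw [hsq, two_mul]
          exact congrArg (· + _) hsqu
  rw [ENNReal.mul_le_mul_iff_right (by norm_num) (by norm_num)] at hle
  rwa [ENNReal.mul_le_mul_iff_left hC0 hCtop] at hle

theorem tsum_gaussianWeight_le {L : AddSubgroup E} [Countable L] {D : Set E}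
    (hD : IsAddFundamentalDomain L D (volume : Measure E)) {t : ℝ} (ht0 : 0 < t) (ht1 : t ≤ 1) :
    ∑' y : L, gaussianWeight t (y : E) ≤
      ENNReal.ofReal ((1 / t) ^ (Module.finrank ℝ E / 2 : ℝ)) *
        ∑' y : L, gaussianWeight 1 (y : E) := by
  rcases ht1.eq_or_lt with rfl | ht1
  · simp
  have ht : 0 < 1 - t := by linarith
  set b : ℝ := t / (1 - t) with hb
  have hb0 : 0 < b := by positivity
  have h1b : 1 + b = 1 / (1 - t) := by rw [hb]; field_simp; ring
  have hbt : 1 * b / (1 + b) = t := by rw [h1b, hb]; field_simp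
  set C : ℝ≥0∞ := ∫⁻ w : E, gaussianWeight (1 + b) w with hC
  have hC' := lintegral_gaussianWeight (E := E) (t := 1 + b) (by positivity)
  have hC0 : C ≠ 0 := by
    rw [hC, hC', Ne, ENNReal.ofReal_eq_zero, not_le]
    positivity
  have hCtop : C ≠ ∞ := by rw [hC, hC']; exact ENNReal.ofReal_ne_top
  have key : (∑' y : L, gaussianWeight t (y : E)) * C ≤
      (ENNReal.ofReal ((1 / t) ^ (Module.finrank ℝ E / 2 : ℝ)) *
        ∑' y : L, gaussianWeight 1 (y : E)) * C := by
    calc (∑' y : L, gaussianWeight t (y : E)) * C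
        = ∫⁻ w : E, (∑' y : L, gaussianWeight 1 (y + -w)) * gaussianWeight b w := by
          simp_rw [← ENNReal.tsum_mul_right]
          rw [lintegral_tsum]
          · refine tsum_congr fun y => ?_
            have := lintegral_gaussianWeight_sub_mul (a := 1) (b := b) (by positivity) (y : E)
            rw [hbt] at this
            rw [hC, ← this]
            simp_rw [sub_eq_add_neg]
          · intro y
            refine Measurable.aemeasurable (.mul ?_ (measurable_gaussianWeight b))
            exact (measurable_gaussianWeight 1).comp
              ((measurable_const_add (y : E)).comp measurable_neg)
      _ ≤ ∫⁻ w : E, (∑' y : L, gaussianWeight 1 (y : E)) * gaussianWeight b w :=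
          lintegral_mono fun w => mul_le_mul_left (tsum_gaussianWeight_add_le hD _) _
      _ = _ := by
          rw [lintegral_const_mul _ (measurable_gaussianWeight b), lintegral_gaussianWeight hb0,
            hC, hC', mul_right_comm, ← ENNReal.ofReal_mul (by positivity),
            ← Real.mul_rpow (by positivity) (by positivity), mul_comm]
          congr 4
          rw [h1b, hb]
          field_simp
  rwa [ENNReal.mul_le_mul_iff_left hC0 hCtop] at key

/-- Banaszczyk's tail bound for the Gaussian mass of a lattice. -/
theorem tsum_gaussianWeight_tail_le {L : AddSubgroup E} [Countable L] {D : Set E}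
    (hD : IsAddFundamentalDomain L D (volume : Measure E)) {c : ℝ}
    (hc : 1 / Real.sqrt (2 * Real.pi) ≤ c) :
    ∑' y : L, (if c * Real.sqrt (Module.finrank ℝ E) ≤ ‖(y : E)‖
        then gaussianWeight 1 (y : E) else 0) ≤
      ENNReal.ofReal ((c * Real.sqrt (2 * Real.pi * Real.exp 1) *
        Real.exp (-Real.pi * c ^ 2)) ^ Module.finrank ℝ E) *
        ∑' y : L, gaussianWeight 1 (y : E) := by
  set n := Module.finrank ℝ E
  have hpi := Real.pi_pos
  have hc0 : 0 < c := lt_of_lt_of_le (by positivity) hc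
  have hc1 : 1 ≤ 2 * Real.pi * c ^ 2 := by
    rw [div_le_iff₀ (by positivity)] at hc
    calc (1 : ℝ) ≤ (c * Real.sqrt (2 * Real.pi)) ^ 2 := one_le_pow₀ hc
      _ = _ := by rw [mul_pow, Real.sq_sqrt (by positivity)]; ring
  set t : ℝ := 1 / (2 * Real.pi * c ^ 2) with ht
  have ht0 : 0 < t := by positivity
  have ht1 : t ≤ 1 := by rw [ht, div_le_one (by positivity)]; exact hc1
  have hpt (y : E) : (if c * Real.sqrt n ≤ ‖y‖ then gaussianWeight 1 y else 0) ≤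
      ENNReal.ofReal (Real.exp (-Real.pi * (1 - t) * (c ^ 2 * n))) * gaussianWeight t y := by
    split_ifs with h
    · have hsq : c ^ 2 * n ≤ ‖y‖ ^ 2 := by
        calc c ^ 2 * n = (c * Real.sqrt n) ^ 2 := by rw [mul_pow, Real.sq_sqrt (by positivity)]
          _ ≤ _ := by gcongr
      rw [gaussianWeight, gaussianWeight, ← ENNReal.ofReal_mul (Real.exp_pos _).le,
        ← Real.exp_add]
      gcongr
      nlinarith [mul_le_mul_of_nonneg_left hsq (mul_nonneg hpi.le (sub_nonneg.2 ht1))]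
    · exact zero_le
  have hconst : Real.exp (-Real.pi * (1 - t) * (c ^ 2 * n)) * (1 / t) ^ (n / 2 : ℝ) =
      (c * Real.sqrt (2 * Real.pi * Real.exp 1) * Real.exp (-Real.pi * c ^ 2)) ^ n := by
    have h1 : (1 / t) ^ (n / 2 : ℝ) = (Real.sqrt (2 * Real.pi) * c) ^ n := by
      rw [show 1 / t = (Real.sqrt (2 * Real.pi) * c) ^ 2 by
        rw [ht, mul_pow, Real.sq_sqrt (by positivity)]; simp, ← Real.rpow_natCast,
        ← Real.rpow_natCast, ← Real.rpow_mul (by positivity)]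
      congr 1
      push_cast
      ring
    have h2 : -Real.pi * (1 - t) * (c ^ 2 * n) = n * (1 / 2 + -Real.pi * c ^ 2) := by
      rw [ht]; field_simp; ring
    rw [h1, h2, Real.exp_nat_mul, Real.exp_add, Real.exp_half, ← mul_pow,
      Real.sqrt_mul (by positivity) (Real.exp 1)]
    ring
  calc _ ≤ ∑' y : L, ENNReal.ofReal (Real.exp (-Real.pi * (1 - t) * (c ^ 2 * n))) *
          gaussianWeight t (y : E) := ENNReal.tsum_le_tsum fun y => hpt y
    _ ≤ ENNReal.ofReal (Real.exp (-Real.pi * (1 - t) * (c ^ 2 * n))) *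
          (ENNReal.ofReal ((1 / t) ^ (n / 2 : ℝ)) * ∑' y : L, gaussianWeight 1 (y : E)) := by
        rw [ENNReal.tsum_mul_left]
        gcongr
        exact tsum_gaussianWeight_le hD ht0 ht1
    _ = _ := by
        rw [← mul_assoc, ← ENNReal.ofReal_mul (Real.exp_pos _).le, hconst]

end GaussianSums

theorem tsum_span_int_range_basis {ι E : Type*} [Finite ι] [AddCommGroup E]
    [Module ℝ E] (b : Module.Basis ι ℝ E) (f : E → ℝ≥0∞) :
    ∑' y : (Submodule.span ℤ (Set.range b)).toAddSubgroup, f y =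
      ∑' z : ι → ℤ, f (b.equivFun.symm fun i => (z i : ℝ)) := by
  have := Fintype.ofFinite ι
  refine Eq.trans ((b.restrictScalars ℤ).equivFun.symm.toEquiv.tsum_eq
    (fun y : Submodule.span ℤ (Set.range b) => f y)).symm (tsum_congr fun z => ?_)
  congr 1
  simp [Module.Basis.equivFun_symm_apply, Int.cast_smul_eq_zsmul]

theorem enorm'_eq_norm {k : ℕ} (x : Fin k → ℝ) : enorm' x = ‖WithLp.toLp 2 x‖ := by
  simp [enorm', EuclideanSpace.norm_eq]

theorem enorm'_sq {k : ℕ} (x : Fin k → ℝ) : enorm' x ^ 2 = x ⬝ᵥ x := by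
  rw [enorm', Real.sq_sqrt (by positivity)]
  simp [dotProduct, sq]

theorem dotProduct_le_enorm'_mul {k : ℕ} (x y : Fin k → ℝ) :
    x ⬝ᵥ y ≤ enorm' x * enorm' y :=
  Real.sum_mul_le_sqrt_mul_sqrt _ _ _

theorem enorm'_transpose_mulVec_le {m k : ℕ} {S : Matrix (Fin m) (Fin k) ℝ} {σ : ℝ}
    (hσ0 : 0 ≤ σ) (hσ : ∀ x, enorm' (S *ᵥ x) ≤ σ * enorm' x) (y : Fin m → ℝ) :
    enorm' (Sᵀ *ᵥ y) ≤ σ * enorm' y := by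
  have hy : 0 ≤ enorm' y := Real.sqrt_nonneg _
  have h0 : 0 ≤ enorm' (Sᵀ *ᵥ y) := Real.sqrt_nonneg _
  rcases h0.eq_or_lt with h | h
  · rw [← h]
    positivity
  · have h1 : enorm' (Sᵀ *ᵥ y) ^ 2 ≤ enorm' y * (σ * enorm' (Sᵀ *ᵥ y)) := by
      rw [enorm'_sq, Matrix.mulVec_transpose, ← Matrix.dotProduct_mulVec,
        ← Matrix.mulVec_transpose]
      exact (dotProduct_le_enorm'_mul _ _).trans (mul_le_mul_of_nonneg_left (hσ _) hy)
    nlinarith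

theorem rho_eq_exp_enorm' {n : ℕ} (S : Matrix (Fin n) (Fin n) ℝ) (x : Fin n → ℝ) :
    rho S x = Real.exp (-Real.pi * enorm' (Sᵀ⁻¹ *ᵥ x) ^ 2) := by
  rw [rho, enorm'_sq, Matrix.mul_inv_rev, ← Matrix.mulVec_mulVec, Matrix.dotProduct_mulVec,
    ← Matrix.mulVec_transpose, Matrix.transpose_nonsing_inv]

/-- Banaszczyk's tail bound for the lattice `Mℤⁿ`. -/
theorem tsum_exp_enorm'_tail_le {n : ℕ} {c : ℝ} (hc : 1 / Real.sqrt (2 * Real.pi) ≤ c)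
    {M : Matrix (Fin n) (Fin n) ℝ} (hM : IsUnit M.det) :
    ∑' z : Fin n → ℤ, (if c * Real.sqrt n ≤ enorm' (M *ᵥ intCast' z)
        then ENNReal.ofReal (Real.exp (-Real.pi * enorm' (M *ᵥ intCast' z) ^ 2)) else 0) ≤
      ENNReal.ofReal ((c * Real.sqrt (2 * Real.pi * Real.exp 1) *
        Real.exp (-Real.pi * c ^ 2)) ^ n) *
        ∑' z : Fin n → ℤ,
          ENNReal.ofReal (Real.exp (-Real.pi * enorm' (M *ᵥ intCast' z) ^ 2)) := by
  have := M.invertibleOfIsUnitDet hM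
  let b : Module.Basis (Fin n) ℝ (EuclideanSpace ℝ (Fin n)) :=
    .ofEquivFun ((M.toLinearEquiv' ‹_›).trans (WithLp.linearEquiv 2 ℝ (Fin n → ℝ)).symm).symm
  have hb (z : Fin n → ℤ) :
      b.equivFun.symm (fun i => (z i : ℝ)) = WithLp.toLp 2 (M *ᵥ intCast' z) := by
    simp [b]
    rfl
  have : Countable (Submodule.span ℤ (Set.range b)).toAddSubgroup :=
    inferInstanceAs (Countable (Submodule.span ℤ (Set.range b)))
  have key := tsum_gaussianWeight_tail_le (ZSpan.isAddFundamentalDomain' b volume) hc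
  rw [tsum_span_int_range_basis b (gaussianWeight 1), tsum_span_int_range_basis b
    (fun y => if _ ≤ ‖y‖ then gaussianWeight 1 y else 0), finrank_euclideanSpace_fin] at key
  simpa only [hb, gaussianWeight, ← enorm'_eq_norm, mul_one] using key

/-- Lemma 2.1, from AGHS Lemma 3. Let `c ≥ 1/√(2π)`, `L = Bℤ^n ⊂ ℝ^n` a
full-rank lattice (`B` invertible, so the dual lattice is `L* = B⁻ᵀℤ^n`), `0 < ε < 1`, and
`S ∈ ℝ^{n×n}` invertible with least singular value `σn` (characterized by `σn‖x‖ ≤ ‖Sx‖`) such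
that `ρ_{1/σn}(L* ∖ {0}) ≤ ε`.  Then `D_{L,S}` assigns to `{v ∈ L : ‖v‖ ≥ σ₁(S)·c·√n}` (with
`σ₁` the largest singular value, characterized by `‖Sx‖ ≤ σ₁‖x‖`) probability at most
`((1+ε)/(1−ε))·(c·√(2πe)·e^{−πc²})^n`. -/
theorem statement11 {n : ℕ} (c : ℝ) (hc : 1 / Real.sqrt (2 * Real.pi) ≤ c)
    (B : Matrix (Fin n) (Fin n) ℝ) (hB : IsUnit B.det)
    (ε : ℝ) (hε0 : 0 < ε) (hε : ε < 1)
    (S : Matrix (Fin n) (Fin n) ℝ) (hS : IsUnit S.det)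
    (σ1 σn : ℝ)
    (hσ1 : ∀ x : Fin n → ℝ, enorm' (S *ᵥ x) ≤ σ1 * enorm' x)
    (hσn : ∀ x : Fin n → ℝ, σn * enorm' x ≤ enorm' (S *ᵥ x))
    (hsmooth : (∑' z : {z : Fin n → ℤ // z ≠ 0},
        Real.exp (-Real.pi * σn ^ 2 * ∑ i, (((B⁻¹)ᵀ *ᵥ intCast' z.1) i) ^ 2)) ≤ ε) :
    (∑' z : Fin n → ℤ,
        if σ1 * c * Real.sqrt n ≤ enorm' (B *ᵥ intCast' z) then rho S (B *ᵥ intCast' z)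
        else 0) /
      (∑' z : Fin n → ℤ, rho S (B *ᵥ intCast' z))
      ≤ (1 + ε) / (1 - ε) *
        (c * Real.sqrt (2 * Real.pi * Real.exp 1) * Real.exp (-Real.pi * c ^ 2)) ^ n := by
  have hpi := Real.pi_pos
  have hc0 : 0 < c := lt_of_lt_of_le (by positivity) hc
  have hS' : IsUnit Sᵀ.det := by rwa [Matrix.det_transpose]
  set M : Matrix (Fin n) (Fin n) ℝ := Sᵀ⁻¹ * B with hMdef
  have hM : IsUnit M.det := by
    rw [hMdef, Matrix.det_mul]
    exact (Matrix.isUnit_nonsing_inv_det _ hS').mul hB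
  have hSM (z : Fin n → ℤ) : Sᵀ *ᵥ (M *ᵥ intCast' z) = B *ᵥ intCast' z := by
    rw [Matrix.mulVec_mulVec, hMdef, Matrix.mul_nonsing_inv_cancel_left _ _ hS']
  have hrho (z : Fin n → ℤ) : rho S (B *ᵥ intCast' z) =
      Real.exp (-Real.pi * enorm' (M *ᵥ intCast' z) ^ 2) := by
    rw [rho_eq_exp_enorm', Matrix.mulVec_mulVec]
  have hnorm (z : Fin n → ℤ) (h : σ1 * c * Real.sqrt n ≤ enorm' (B *ᵥ intCast' z)) :
      c * Real.sqrt n ≤ enorm' (M *ᵥ intCast' z) := by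
    rcases n.eq_zero_or_pos with rfl | hn
    · simp [enorm']
    have hσ : 0 < σ1 := by
      by_contra! hneg
      have h1 := hσ1 1
      have h2 : 0 < enorm' (1 : Fin n → ℝ) := by simp [enorm', hn]
      have h3 : enorm' (S *ᵥ 1) ^ 2 = 0 := by
        rw [le_antisymm (h1.trans (mul_nonpos_of_nonpos_of_nonneg hneg h2.le)) (Real.sqrt_nonneg _)]
        simp
      rw [enorm'_sq, dotProduct_self_eq_zero] at h3
      have h4 := congrArg (S⁻¹ *ᵥ ·) h3
      simp only [Matrix.mulVec_mulVec, Matrix.nonsing_inv_mul _ hS, Matrix.one_mulVec,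
        Matrix.mulVec_zero] at h4
      exact one_ne_zero (congrFun h4 ⟨0, hn⟩)
    have h5 := enorm'_transpose_mulVec_le hσ.le hσ1 (M *ᵥ intCast' z)
    rw [hSM] at h5
    exact le_of_mul_le_mul_left (by linarith) hσ
  set K : ℝ := (c * Real.sqrt (2 * Real.pi * Real.exp 1) * Real.exp (-Real.pi * c ^ 2)) ^ n
    with hK
  have hK0 : 0 ≤ K := by positivity
  have hfactor : 1 ≤ (1 + ε) / (1 - ε) := by
    rw [one_le_div (by linarith)]
    linarith
  refine le_trans ?_ (le_mul_of_one_le_left hK0 hfactor)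
  by_cases hsum : Summable fun z : Fin n → ℤ => rho S (B *ᵥ intCast' z)
  swap
  · rwa [tsum_eq_zero_of_not_summable hsum, div_zero]
  have hpos (z : Fin n → ℤ) : 0 ≤ rho S (B *ᵥ intCast' z) := (Real.exp_pos _).le
  refine div_le_of_le_mul₀ (tsum_nonneg hpos) hK0 ?_
  have hite (z : Fin n → ℤ) : 0 ≤ if σ1 * c * Real.sqrt n ≤ enorm' (B *ᵥ intCast' z) then
      rho S (B *ᵥ intCast' z) else 0 := by
    split_ifs
    exacts [hpos z, le_rfl]
  have hsum' : Summable fun z : Fin n → ℤ =>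
      if σ1 * c * Real.sqrt n ≤ enorm' (B *ᵥ intCast' z) then rho S (B *ᵥ intCast' z) else 0 := by
    refine hsum.of_nonneg_of_le hite fun z => ?_
    split_ifs
    exacts [le_rfl, hpos z]
  rw [← ENNReal.ofReal_le_ofReal_iff (mul_nonneg hK0 (tsum_nonneg hpos)),
    ENNReal.ofReal_mul hK0, ENNReal.ofReal_tsum_of_nonneg hite hsum',
    ENNReal.ofReal_tsum_of_nonneg hpos hsum]
  simp_rw [hrho]
  refine le_trans (ENNReal.tsum_le_tsum fun z => ?_) (tsum_exp_enorm'_tail_le hc hM)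
  split_ifs with h1 h2 h2
  · exact le_rfl
  · exact absurd (hnorm z h1) h2
  · simp
  · simp
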